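/- Let p ≥ 5 be a prime, m ∈ ℕ, let c : ℕ × ℤ → ZMod p be a formal Jacobi–Fourier expansion mod p, and let b ∈ ZMod p with b ≠ 0. Then c has a Ramanujan-type congruence at b if and only if Σ_{i=1}^{p−1} b^(p−1−i) · (L_m^i c) = 0 as a function ℕ × ℤ → ZMod p. (This is equation (KO eqn 1) in the proof of Proposition 2.4.) -/

import Mathlib

/-- The heat operator `L_m` acting on formal Jacobi–Fourier expansions mod `p`:
`(L_m c)(n,r) = (4nm - r²) * c(n,r)`. -/
def heatOp (p m : ℕ) (c : ℕ × ℤ → ZMod p) : ℕ × ℤ → ZMod p :=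
  fun t => ((4 * (t.1 : ℤ) * (m : ℤ) - t.2 ^ 2 : ℤ) : ZMod p) * c t

theorem heatOp_iterate_apply (p m i : ℕ) (c : ℕ × ℤ → ZMod p) (t : ℕ × ℤ) :
    (heatOp p m)^[i] c t =
      ((4 * (t.1 : ℤ) * (m : ℤ) - t.2 ^ 2 : ℤ) : ZMod p) ^ i * c t := by
  induction i with
  | zero => simp
  | succ i ih => rw [Function.iterate_succ_apply', heatOp, ih, pow_succ' _ i, mul_assoc (Int.cast _)]

theorem sum_Icc_pow_mul_pow_eq_mul_geom_sum {R : Type*} [CommSemiring R] (a b : R) (n : ℕ) :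
    ∑ i ∈ Finset.Icc 1 n, b ^ (n - i) * a ^ i =
      a * ∑ i ∈ Finset.range n, a ^ i * b ^ (n - 1 - i) := by
  rw [← Finset.Ico_add_one_right_eq_Icc, Finset.sum_Ico_eq_sum_range, Finset.mul_sum,
    Nat.add_sub_cancel]
  refine Finset.sum_congr rfl fun i _ => ?_
  rw [Nat.sub_sub, pow_add]
  ring

/-- Up to sign, the polynomial is the indicator function of `b`. -/
theorem ZMod.sum_Icc_pow_mul_pow (p : ℕ) [Fact p.Prime] (a b : ZMod p) (hb : b ≠ 0) :
    ∑ i ∈ Finset.Icc 1 (p - 1), b ^ (p - 1 - i) * a ^ i = if a = b then -1 else 0 := by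
  split_ifs with hab
  · subst hab
    have hterm : ∀ i ∈ Finset.Icc 1 (p - 1), a ^ (p - 1 - i) * a ^ i = 1 := fun i hi => by
      rw [← pow_add, Nat.sub_add_cancel (Finset.mem_Icc.mp hi).2, ZMod.pow_card_sub_one_eq_one hb]
    rw [Finset.sum_congr rfl hterm]
    simp [Nat.cast_sub (Fact.out : p.Prime).one_le]
  · rw [sum_Icc_pow_mul_pow_eq_mul_geom_sum]
    rcases eq_or_ne a 0 with rfl | ha
    · exact zero_mul _
    · refine mul_eq_zero_of_right _
        (eq_zero_of_ne_zero_of_mul_right_eq_zero (sub_ne_zero.mpr hab) ?_)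
      rw [geom_sum₂_mul, ZMod.pow_card_sub_one_eq_one ha, ZMod.pow_card_sub_one_eq_one hb, sub_self]

theorem stmt_4 (p : ℕ) [Fact p.Prime] (hp5 : 5 ≤ p) (m : ℕ)
    (c : ℕ × ℤ → ZMod p) (b : ZMod p) (hb : b ≠ 0) :
    (∀ (n : ℕ) (r : ℤ), ((4 * (n : ℤ) * (m : ℤ) - r ^ 2 : ℤ) : ZMod p) = b →
        c (n, r) = 0)
      ↔ (fun t => ∑ i ∈ Finset.Icc 1 (p - 1),
            b ^ (p - 1 - i) * (heatOp p m)^[i] c t) = (fun _ => (0 : ZMod p)) := by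
  simp only [heatOp_iterate_apply, ← mul_assoc, ← Finset.sum_mul,
    ZMod.sum_Icc_pow_mul_pow p _ b hb]
  simp [funext_iff]
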